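/- arXiv:1710.00407 — 4 statements merged into one kernel-verified Lean document; each statement's English description precedes it below -/
import Mathlib

section
/- Let k be a field, d a positive natural number whose image in k is nonzero (i.e. the characteristic of k does not divide d), and let f₀, f₁, f₂, f₃ ∈ R = k[X₀, X₁, X₂] be homogeneous polynomials of degree d. For i = 0,1,2,3 let Dᵢ = (−1)ⁱ·det(Jᵢ), where Jᵢ is the 3×3 matrix obtained from the Jacobian matrix J(f) = (∂fᵢ/∂Xⱼ) by deleting the i-th row. Then D₀f₀ + D₁f₁ + D₂f₂ + D₃f₃ = 0; that is, (D₀, D₁, D₂, D₃) is a syzygy of f₀, f₁, f₂, f₃. -/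
open MvPolynomial Matrix

namespace Matrix

/-- The signed maximal minors of an `(n + 1) × n` matrix annihilate its column space. -/
theorem sum_neg_one_pow_mul_det_succAbove_mul_mulVec {R : Type*} [CommRing R] {n : ℕ}
    (A : Matrix (Fin (n + 1)) (Fin n) R) (x : Fin n → R) :
    ∑ i : Fin (n + 1), (-1) ^ (i : ℕ) * (A.submatrix i.succAbove id).det * (A *ᵥ x) i = 0 := by
  let M : Matrix (Fin (n + 1)) (Fin (n + 1)) R := of fun i => Fin.cons ((A *ᵥ x) i) (A i)
  let v : Fin (n + 1) → R := Fin.cons (-1) x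
  have hMv : M *ᵥ v = 0 := by
    ext i
    simp [M, v, mulVec, dotProduct, Fin.sum_univ_succ]
  have hdet : M.det • v = 0 := by
    rw [← one_mulVec v, ← smul_mulVec, ← adjugate_mul, ← mulVec_mulVec, hMv, mulVec_zero]
  have hzero : M.det = 0 := by simpa [v] using congrFun hdet 0
  rw [det_succ_column_zero] at hzero
  rw [← hzero]
  refine Finset.sum_congr rfl fun i _ => ?_
  rw [show M.submatrix i.succAbove Fin.succ = A.submatrix i.succAbove id from rfl,
    show M i 0 = (A *ᵥ x) i from rfl]
  ring

end Matrix

/-- If `f₀,…,f₃ ∈ k[X₀,X₁,X₂]` are homogeneous of degree `d`, where the characteristic of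
the field `k` does not divide `d`, and `Dᵢ` is the signed maximal minor `(-1)ⁱ · det` of the
`3×3` matrix obtained from the Jacobian matrix `J(f) = (∂fᵢ/∂Xⱼ)` by deleting row `i`, then
`D₀f₀ + D₁f₁ + D₂f₂ + D₃f₃ = 0`, i.e. `(D₀,D₁,D₂,D₃)` is a syzygy of `f₀,…,f₃`. -/
theorem jacobian_minors_syzygy (k : Type*) [Field k] (d : ℕ) (hd : 0 < d)
    (hdk : (d : k) ≠ 0)
    (f : Fin 4 → MvPolynomial (Fin 3) k)
    (hf : ∀ i, (f i).IsHomogeneous d)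
    (D : Fin 4 → MvPolynomial (Fin 3) k)
    (hD : ∀ i, D i = (-1 : MvPolynomial (Fin 3) k) ^ (i : ℕ) *
      (Matrix.of fun (r c : Fin 3) => pderiv c (f (i.succAbove r))).det) :
    ∑ i : Fin 4, D i * f i = 0 := by
  have euler : ∀ i, ((of fun i c => pderiv c (f i)) *ᵥ X) i = (d : MvPolynomial (Fin 3) k) * f i := by
    intro i
    rw [← nsmul_eq_mul, ← (hf i).sum_X_mul_pderiv]
    simp only [mulVec, dotProduct, of_apply, mul_comm]
  have hd_ne : (d : MvPolynomial (Fin 3) k) ≠ 0 := by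
    rw [← map_natCast (C : k →+* MvPolynomial (Fin 3) k)]
    exact C_ne_zero.mpr hdk
  refine (mul_eq_zero.mp ?_).resolve_left hd_ne
  rw [← sum_neg_one_pow_mul_det_succAbove_mul_mulVec (of fun i c => pderiv c (f i)) X,
    Finset.mul_sum]
  refine Finset.sum_congr rfl fun i _ => ?_
  rw [euler, hD, mul_left_comm]
  rfl
end

section
/- Let k be a field, d a positive natural number whose image in k is nonzero, and let f₀, f₁, f₂, f₃ ∈ R = k[X₀, X₁, X₂] be homogeneous polynomials of degree d. For i = 0,1,2,3 let Dᵢ = (−1)ⁱ·det(Jᵢ), where Jᵢ is the 3×3 matrix obtained from the Jacobian matrix J(f) = (∂fᵢ/∂Xⱼ) by deleting the i-th row. Let δ ≤ 3(d−1) and let F ∈ R be a nonzero homogeneous polynomial of degree 3(d−1) − δ that divides each Dᵢ, and write Dᵢ = F·aᵢ. Then each aᵢ is homogeneous of degree δ and a₀f₀ + a₁f₁ + a₂f₂ + a₃f₃ = 0. In particular, if not all Dᵢ are zero, the ideal I = (f₀,…,f₃) admits a nonzero syzygy in degree δ. -/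
open MvPolynomial Matrix

namespace Matrix

/-- A square matrix whose entries are homogeneous polynomials of degree `e` has a homogeneous
determinant. -/
theorem isHomogeneous_det {n σ R : Type*} [Fintype n] [DecidableEq n] [CommRing R]
    {M : Matrix n n (MvPolynomial σ R)} {e : ℕ} (hM : ∀ i j, (M i j).IsHomogeneous e) :
    M.det.IsHomogeneous (Fintype.card n * e) := by
  rw [det_apply]
  refine IsHomogeneous.sum _ _ _ fun τ _ => ?_
  have hprod : (∏ i, M (τ i) i).IsHomogeneous (Fintype.card n * e) := by
    simpa using IsHomogeneous.prod Finset.univ (fun i => M (τ i) i) (fun _ => e)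
      fun i _ => hM (τ i) i
  rcases Int.units_eq_one_or (Equiv.Perm.sign τ) with h | h
  · simpa [h] using hprod
  · simpa [h] using hprod.neg

/-- The signed maximal minors of an `(n + 1) × n` matrix annihilate its columns. -/
theorem sum_signed_minor_mul_eq_zero {n : ℕ} {R : Type*} [CommRing R]
    (M : Matrix (Fin (n + 1)) (Fin n) R) (j : Fin n) :
    ∑ i : Fin (n + 1), (-1) ^ (i : ℕ) * (M.submatrix i.succAbove id).det * M i j = 0 := by
  let N : Matrix (Fin (n + 1)) (Fin (n + 1)) R := of fun i => Fin.cons (M i j) (M i)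
  have hN : N.det = 0 := det_zero_of_column_eq (Fin.succ_ne_zero j).symm fun i => by simp [N]
  rw [det_succ_column_zero] at hN
  rw [← hN]
  refine Finset.sum_congr rfl fun i _ => ?_
  have hsub : N.submatrix i.succAbove Fin.succ = M.submatrix i.succAbove id := by
    ext
    simp [N]
  rw [hsub, mul_right_comm]
  simp [N]

end Matrix

namespace MvPolynomial

attribute [local instance] gradedAlgebra in
/-- A cofactor of a nonzero homogeneous divisor of a homogeneous polynomial is homogeneous. -/
theorem IsHomogeneous.of_mul_left {σ R : Type*} [CommRing R] [IsDomain R]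
    {p q : MvPolynomial σ R} {m n : ℕ} (hp : p.IsHomogeneous m) (hp0 : p ≠ 0)
    (hpq : (p * q).IsHomogeneous (m + n)) : q.IsHomogeneous n := by
  have h := DirectSum.coe_decompose_mul_add_of_left_mem (homogeneousSubmodule σ R)
    (j := n) (b := q) hp
  rw [DirectSum.decompose_of_mem_same _ hpq] at h
  rw [mul_left_cancel₀ hp0 h]
  exact (DirectSum.decompose (homogeneousSubmodule σ R) q n).2

/-- If `c` annihilates every partial derivative column of the forms `f i` of degree `d`, and `d` is
nonzero in the field `k`, then `c` is a syzygy of the `f i`. -/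
theorem sum_mul_eq_zero_of_sum_mul_pderiv_eq_zero {ι σ k : Type*} [Fintype ι] [Fintype σ] [Field k]
    {d : ℕ} (hd : (d : k) ≠ 0) {f c : ι → MvPolynomial σ k} (hf : ∀ i, (f i).IsHomogeneous d)
    (h : ∀ j, ∑ i, c i * pderiv j (f i) = 0) : ∑ i, c i * f i = 0 := by
  have hd' : (d : MvPolynomial σ k) ≠ 0 := by
    rw [← map_natCast (C : k →+* MvPolynomial σ k)]
    simpa only [ne_eq, C_eq_zero] using hd
  refine (mul_eq_zero.mp ?_).resolve_left hd'
  calc (d : MvPolynomial σ k) * ∑ i, c i * f i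
      = ∑ i, c i * ∑ j, X j * pderiv j (f i) := by
        rw [Finset.mul_sum]
        refine Finset.sum_congr rfl fun i _ => ?_
        rw [(hf i).sum_X_mul_pderiv, nsmul_eq_mul, mul_left_comm]
    _ = ∑ j, X j * ∑ i, c i * pderiv j (f i) := by
        simp_rw [Finset.mul_sum]
        rw [Finset.sum_comm]
        simp_rw [mul_left_comm]
    _ = 0 := by simp [h]

end MvPolynomial

/-- **Proposition 2.9.** Let `f₀,…,f₃ ∈ k[X₀,X₁,X₂]` be homogeneous of degree `d`, where the
characteristic of the field `k` does not divide `d`. Let `Dᵢ` be the signed maximal minor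
`(-1)ⁱ · det` of the `3×3` matrix obtained from the Jacobian matrix `J(f) = (∂fᵢ/∂Xⱼ)` by
deleting row `i`. If `δ ≤ 3(d-1)` and `F` is a nonzero homogeneous polynomial of degree
`3(d-1) - δ` with `Dᵢ = F·aᵢ` for all `i`, then each `aᵢ` is homogeneous of degree `δ` and
`a₀f₀ + a₁f₁ + a₂f₂ + a₃f₃ = 0`: the ideal `I = (f₀,…,f₃)` has a syzygy in degree `δ`. -/
theorem syzygy_in_degree_delta (k : Type*) [Field k] (d : ℕ) (hd : 0 < d)
    (hdk : (d : k) ≠ 0)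
    (f : Fin 4 → MvPolynomial (Fin 3) k)
    (hf : ∀ i, (f i).IsHomogeneous d)
    (D : Fin 4 → MvPolynomial (Fin 3) k)
    (hD : ∀ i, D i = (-1 : MvPolynomial (Fin 3) k) ^ (i : ℕ) *
      (Matrix.of fun (r c : Fin 3) => pderiv c (f (i.succAbove r))).det)
    (δ : ℕ) (hδ : δ ≤ 3 * (d - 1))
    (F : MvPolynomial (Fin 3) k) (hF0 : F ≠ 0)
    (hFhom : F.IsHomogeneous (3 * (d - 1) - δ))
    (a : Fin 4 → MvPolynomial (Fin 3) k)
    (hFa : ∀ i, D i = F * a i) :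
    (∀ i, (a i).IsHomogeneous δ) ∧ ∑ i : Fin 4, a i * f i = 0 := by
  let J : Matrix (Fin 4) (Fin 3) (MvPolynomial (Fin 3) k) := of fun i j => pderiv j (f i)
  have hDJ : ∀ i, D i = (-1) ^ (i : ℕ) * (J.submatrix i.succAbove id).det := hD
  constructor
  · intro i
    refine hFhom.of_mul_left hF0 ?_
    rw [← hFa, Nat.sub_add_cancel hδ, hDJ]
    have hdet : (J.submatrix i.succAbove id).det.IsHomogeneous (3 * (d - 1)) := by
      simpa using isHomogeneous_det (M := J.submatrix i.succAbove id)
        fun r c => (hf (i.succAbove r)).pderiv (i := c)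
    rcases neg_one_pow_eq_or (MvPolynomial (Fin 3) k) (i : ℕ) with h | h
    · simpa [h] using hdet
    · simpa [h] using hdet.neg
  · have hsyz : ∑ i, D i * f i = 0 :=
      sum_mul_eq_zero_of_sum_mul_pderiv_eq_zero hdk hf fun j => by
        simpa only [hDJ, J, of_apply] using sum_signed_minor_mul_eq_zero J j
    refine (mul_eq_zero.mp ?_).resolve_left hF0
    simpa only [hFa, mul_assoc, ← Finset.mul_sum] using hsyz
end

section
/- Let k be a field, d a positive natural number whose image in k is nonzero, and let f₀, f₁, f₂, f₃ ∈ R = k[X₀, X₁, X₂] be homogeneous polynomials of degree d. For i = 0,1,2,3 let Dᵢ = (−1)ⁱ·det(Jᵢ), where Jᵢ is the 3×3 matrix obtained from the Jacobian matrix J(f) = (∂fᵢ/∂Xⱼ) by deleting the i-th row, and assume that not all Dᵢ are zero. If there exists a homogeneous polynomial F of degree 3(d−1) dividing every Dᵢ, then f₀, f₁, f₂, f₃ are linearly dependent over k, i.e. there exist c₀, c₁, c₂, c₃ ∈ k, not all zero, with c₀f₀ + c₁f₁ + c₂f₂ + c₃f₃ = 0. -/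
open MvPolynomial Matrix

/-- The determinant of a matrix whose entries are homogeneous of degree `m` is homogeneous. -/
theorem MvPolynomial.isHomogeneous_det {σ R n : Type*} [CommRing R] [Fintype n] [DecidableEq n]
    {m : ℕ} (A : Matrix n n (MvPolynomial σ R)) (hA : ∀ i j, (A i j).IsHomogeneous m) :
    A.det.IsHomogeneous (Fintype.card n * m) := by
  rw [Matrix.det_apply']
  refine IsHomogeneous.sum _ _ _ fun τ _ => ?_
  have hprod := IsHomogeneous.prod Finset.univ (fun i => A (τ i) i) (fun _ => m)
    fun i _ => hA (τ i) i
  have hsign : (((Equiv.Perm.sign τ : ℤ) : MvPolynomial σ R)).IsHomogeneous 0 := by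
    simpa using isHomogeneous_C σ ((Equiv.Perm.sign τ : ℤ) : R)
  simpa using hsign.mul hprod

/-- If a nonzero polynomial of total degree `n` divides a homogeneous polynomial of
degree `n`, then the quotient is a constant. -/
theorem MvPolynomial.exists_eq_mul_C_of_dvd {σ R : Type*} [CommRing R] [IsDomain R] {n : ℕ}
    {F G : MvPolynomial σ R} (hF0 : F ≠ 0) (hF : F.IsHomogeneous n) (hG : G.IsHomogeneous n)
    (h : F ∣ G) : ∃ c : R, G = F * C c := by
  obtain ⟨q, rfl⟩ := h
  by_cases hq : q = 0
  · exact ⟨0, by simp [hq]⟩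
  have hdeg := totalDegree_mul_of_isDomain hF0 hq
  rw [hG.totalDegree (mul_ne_zero hF0 hq), hF.totalDegree hF0] at hdeg
  exact ⟨coeff 0 q, by rw [← totalDegree_eq_zero_iff_eq_C.mp (by lia)]⟩

/-- The signed maximal minors of a `4 × 3` matrix give a relation between its rows. -/
theorem Matrix.sum_signed_minor_mul_eq_zero_s4 {R : Type*} [CommRing R]
    (A : Matrix (Fin 4) (Fin 3) R) (j : Fin 3) :
    ∑ i : Fin 4, (-1) ^ (i : ℕ) * (Matrix.of fun r c : Fin 3 => A (i.succAbove r) c).det * A i j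
      = 0 := by
  have h := Matrix.det_succ_column_zero (Matrix.of fun i : Fin 4 => Fin.cons (A i j) (A i))
  rw [Matrix.det_zero_of_column_eq (Fin.succ_ne_zero j).symm (fun i => by simp)] at h
  rw [h]
  refine Finset.sum_congr rfl fun i _ => ?_
  rw [mul_right_comm]
  rfl

/-- **One direction of Corollary 2.10.** Let `f₀,…,f₃ ∈ k[X₀,X₁,X₂]` be homogeneous of
degree `d`, where the characteristic of the field `k` does not divide `d`, and let `Dᵢ` be
the signed maximal minor `(-1)ⁱ · det` of the `3×3` matrix obtained from the Jacobian
matrix `J(f)` by deleting row `i`; assume not all `Dᵢ` are zero. If a homogeneous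
polynomial `F` of degree `3(d-1)` divides every `Dᵢ`, then `f₀,…,f₃` are linearly dependent
over `k`. -/
theorem linearly_dependent_of_gcd_max_degree (k : Type*) [Field k] (d : ℕ) (hd : 0 < d)
    (hdk : (d : k) ≠ 0)
    (f : Fin 4 → MvPolynomial (Fin 3) k)
    (hf : ∀ i, (f i).IsHomogeneous d)
    (D : Fin 4 → MvPolynomial (Fin 3) k)
    (hD : ∀ i, D i = (-1 : MvPolynomial (Fin 3) k) ^ (i : ℕ) *
      (Matrix.of fun (r c : Fin 3) => pderiv c (f (i.succAbove r))).det)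
    (hne : ∃ i, D i ≠ 0)
    (F : MvPolynomial (Fin 3) k) (hF0 : F ≠ 0)
    (hFhom : F.IsHomogeneous (3 * (d - 1)))
    (hFdvd : ∀ i, F ∣ D i) :
    ∃ c : Fin 4 → k, (∃ i, c i ≠ 0) ∧ ∑ i : Fin 4, C (c i) * f i = 0 := by
  have hDhom (i : Fin 4) : (D i).IsHomogeneous (3 * (d - 1)) := by
    have hdet := isHomogeneous_det (Matrix.of fun (r c : Fin 3) => pderiv c (f (i.succAbove r)))
      fun r c => (hf (i.succAbove r)).pderiv
    have hsign : ((-1 : MvPolynomial (Fin 3) k) ^ (i : ℕ)).IsHomogeneous 0 := by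
      simpa using isHomogeneous_C (Fin 3) ((-1 : k) ^ (i : ℕ))
    rw [hD i]
    simpa using hsign.mul hdet
  choose c hc using fun i => exists_eq_mul_C_of_dvd hF0 hFhom (hDhom i) (hFdvd i)
  refine ⟨c, ?_, ?_⟩
  · obtain ⟨i, hi⟩ := hne
    exact ⟨i, fun h => hi (by rw [hc i, h, C_0, mul_zero])⟩
  have hrel (j : Fin 3) : ∑ i : Fin 4, C (c i) * pderiv j (f i) = 0 := by
    have h := Matrix.sum_signed_minor_mul_eq_zero_s4
      (Matrix.of fun (i : Fin 4) (j : Fin 3) => pderiv j (f i)) j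
    simp only [Matrix.of_apply, ← hD, hc, mul_assoc, ← Finset.mul_sum] at h
    exact (mul_eq_zero.mp h).resolve_left hF0
  have heuler : C (d : k) * ∑ i : Fin 4, C (c i) * f i = 0 := by
    calc C (d : k) * ∑ i : Fin 4, C (c i) * f i
        = ∑ i : Fin 4, C (c i) * ∑ j : Fin 3, X j * pderiv j (f i) := by
          rw [Finset.mul_sum]
          refine Finset.sum_congr rfl fun i _ => ?_
          rw [(hf i).sum_X_mul_pderiv, nsmul_eq_mul, map_natCast, mul_left_comm]
      _ = ∑ j : Fin 3, X j * ∑ i : Fin 4, C (c i) * pderiv j (f i) := by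
          simp only [Finset.mul_sum]
          rw [Finset.sum_comm]
          simp only [mul_left_comm]
      _ = 0 := by simp [hrel]
  exact (mul_eq_zero.mp heuler).resolve_left (C_ne_zero.mpr hdk)
end

section
/- Let k be a field, m, n natural numbers, and let f, g₁,…,gₙ ∈ R = k[X₀,…,X_m]. Let h₁,…,h_r ∈ R, let e₁,…,e_r be positive integers, and set h = h₁^{e₁}⋯h_r^{e_r}. Define f′₀ = f and f′ᵢ = h·gᵢ for 1 ≤ i ≤ n. Then the product h₁^{2e₁−1}⋯h_r^{2e_r−1} divides every 3×3 minor of the Jacobian matrix J(f′₀, f′₁,…,f′ₙ). -/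
open MvPolynomial Matrix

theorem Derivation.prod_pow_sub_one_dvd {R A ι : Type*} [CommSemiring R] [CommRing A] [Algebra R A]
    (d : Derivation R A A) (s : Finset ι) (h : ι → A) (e : ι → ℕ) :
    ∏ l ∈ s, h l ^ (e l - 1) ∣ d (∏ l ∈ s, h l ^ e l) := by
  classical
  induction s using Finset.induction_on with
  | empty => simp
  | insert a s ha ih =>
    rw [Finset.prod_insert ha, Finset.prod_insert ha, Derivation.leibniz, smul_eq_mul, smul_eq_mul]
    refine dvd_add (mul_dvd_mul (pow_dvd_pow _ (Nat.sub_le _ _)) ih) ?_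
    rw [mul_comm]
    refine mul_dvd_mul (Finset.prod_dvd_prod_of_dvd _ _ fun l _ =>
      pow_dvd_pow _ (Nat.sub_le _ _)) ?_
    rw [Derivation.leibniz_pow, smul_eq_mul, nsmul_eq_mul]
    exact (Dvd.intro _ rfl).mul_left _

/-- If two rows of a square matrix are divisible by `D` and, after division by `D`, are multiples of
a common vector `w` modulo `Q`, then `D ^ 2 * Q` divides the determinant. -/
theorem Matrix.sq_mul_dvd_det_of_two_rows {ι A : Type*} [Fintype ι] [DecidableEq ι] [CommRing A]
    (M : Matrix ι ι A) {p q : ι} (hpq : p ≠ q) (D Q s t : A) (a b w : ι → A)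
    (hp : M p = D • (Q • a + s • w)) (hq : M q = D • (Q • b + t • w)) :
    D ^ 2 * Q ∣ M.det := by
  have hM : M = (M.updateRow p (D • (Q • a + s • w))).updateRow q (D • (Q • b + t • w)) := by
    rw [← hp, ← hq, updateRow_eq_self, updateRow_eq_self]
  have hw : ((M.updateRow q w).updateRow p w).det = 0 :=
    det_zero_of_row_eq hpq (by rw [updateRow_self, updateRow_ne hpq.symm, updateRow_self])
  rw [hM, det_updateRow_smul, det_updateRow_add, det_updateRow_smul, det_updateRow_smul,
    updateRow_comm _ hpq, updateRow_comm _ hpq, det_updateRow_smul, det_updateRow_smul,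
    det_updateRow_add, det_updateRow_add, det_updateRow_smul, det_updateRow_smul,
    det_updateRow_smul, det_updateRow_smul, hw]
  refine ⟨Q * ((M.updateRow q b).updateRow p a).det + s * ((M.updateRow q b).updateRow p w).det +
    t * ((M.updateRow q w).updateRow p a).det, ?_⟩
  ring

theorem exists_ne_of_injective_fin_three {α : Type*} (v : Fin 3 → α) (hv : Function.Injective v)
    (x : α) : ∃ p q, p ≠ q ∧ v p ≠ x ∧ v q ≠ x := by
  by_cases h0 : v 0 = x
  · exact ⟨1, 2, by decide, h0 ▸ hv.ne (by decide), h0 ▸ hv.ne (by decide)⟩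
  by_cases h1 : v 1 = x
  · exact ⟨0, 2, by decide, h0, h1 ▸ hv.ne (by decide)⟩
  · exact ⟨0, 1, by decide, h0, h1⟩

/-- **Central computation of Theorem 2.5.** Let `f, g₁,…,gₙ ∈ k[X₀,…,X_m]`, let
`h₁,…,h_r ∈ R` and positive integers `e₁,…,e_r`, and set `h = h₁^{e₁}⋯h_r^{e_r}`. Define
`f′₀ = f` and `f′ᵢ = h·gᵢ` for `1 ≤ i ≤ n`. Then `h₁^{2e₁-1}⋯h_r^{2e_r-1}` divides every
`3×3` minor of the Jacobian matrix `J(f′₀,…,f′ₙ)`. -/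
theorem pow_dvd_jacobian_minor (k : Type*) [Field k] (m n r : ℕ)
    (f : MvPolynomial (Fin (m + 1)) k)
    (g : Fin n → MvPolynomial (Fin (m + 1)) k)
    (h : Fin r → MvPolynomial (Fin (m + 1)) k)
    (e : Fin r → ℕ) (he : ∀ l, 0 < e l)
    (f' : Fin (n + 1) → MvPolynomial (Fin (m + 1)) k)
    (hf'0 : f' 0 = f)
    (hf's : ∀ i : Fin n, f' i.succ = (∏ l : Fin r, h l ^ e l) * g i)
    (rows : Fin 3 → Fin (n + 1)) (cols : Fin 3 → Fin (m + 1))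
    (hrows : Function.Injective rows) (hcols : Function.Injective cols) :
    (∏ l : Fin r, h l ^ (2 * e l - 1)) ∣
      ((Matrix.of fun (i : Fin (n + 1)) (j : Fin (m + 1)) =>
          pderiv j (f' i)).submatrix rows cols).det := by
  obtain ⟨p, q, hpq, hp, hq⟩ := exists_ne_of_injective_fin_three rows hrows 0
  obtain ⟨a, ha⟩ := Fin.exists_succ_eq.mpr hp
  obtain ⟨b, hb⟩ := Fin.exists_succ_eq.mpr hq
  choose w hw using fun j : Fin (m + 1) =>
    (pderiv (R := k) j).prod_pow_sub_one_dvd Finset.univ h e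
  have hP : ∏ l, h l ^ e l = (∏ l, h l ^ (e l - 1)) * ∏ l, h l := by
    rw [← Finset.prod_mul_distrib]
    exact Finset.prod_congr rfl fun l _ => (pow_sub_one_mul (he l).ne' _).symm
  have htarget : ∏ l, h l ^ (2 * e l - 1) = (∏ l, h l ^ (e l - 1)) ^ 2 * ∏ l, h l := by
    rw [sq, mul_assoc, ← hP, ← Finset.prod_mul_distrib]
    refine Finset.prod_congr rfl fun l _ => ?_
    rw [← pow_add]
    congr 1
    have := he l
    omega
  have hrow (i : Fin n) (j : Fin (m + 1)) : pderiv j (f' i.succ) =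
      (∏ l, h l ^ (e l - 1)) * ((∏ l, h l) * pderiv j (g i) + g i * w j) := by
    rw [hf's, Derivation.leibniz, hw, smul_eq_mul, smul_eq_mul, hP]
    ring
  rw [htarget]
  refine sq_mul_dvd_det_of_two_rows _ hpq _ _ (g a) (g b) (fun j => pderiv (cols j) (g a))
    (fun j => pderiv (cols j) (g b)) (fun j => w (cols j)) ?_ ?_
  · ext1 j
    simp only [submatrix_apply, of_apply, ← ha, hrow, Pi.smul_apply, Pi.add_apply, smul_eq_mul]
  · ext1 j
    simp only [submatrix_apply, of_apply, ← hb, hrow, Pi.smul_apply, Pi.add_apply, smul_eq_mul]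
end
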